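/- Correctness of the reduction from Index to Pigeon: Given an Index instance (s, f, id, g, t) with n = ⌈log₂ s⌉, define C : {0,1}^n → {0,1}^n by C(x) = bits_n of the natural number ((I(val x) − t) mod s) (the difference computed in the integers and reduced modulo s to a value in [s]) if val x < s, and C(x) = x otherwise. Then: (a) if C(x) = 0^n for some x ∈ {0,1}^n, then IndexSol holds; (b) if x ≠ y and C(x) = C(y), then IndexSol holds; where IndexSol denotes: (∃ x < s, I(x) = t) ∨ (∃ x, y < s, f_G(x,y) ≥ s) ∨ (∃ distinct x, y < s, I(x) = I(y)). -/

import Mathlib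

/-- The number whose binary expansion (most significant bit first) is `u`. -/
def valS {n : ℕ} (u : Fin n → Bool) : ℕ :=
  (List.ofFn u).foldl (fun a b => 2*a + (if b then 1 else 0)) 0

/-- The length-`n` binary expansion (most significant bit first) of `m`. -/
def bitsS (n : ℕ) (m : ℕ) : Fin n → Bool := fun i => m.testBit (n - 1 - (i : ℕ))

/-- Square-and-multiply over the binary digits of `x` (most significant bit first,
with the single digit 0 for `x = 0`), starting from `e`. -/
def sqmul {α : Type*} (sq : α → α) (mul : α → α) (e : α) (x : ℕ) : α :=
  (if x = 0 then [false] else x.bits.reverse).foldl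
    (fun r b => if b then mul (sq r) else sq r) e

/-- The binary operator on indices induced by the circuit `f`. -/
def fG (n : ℕ) (f : (Fin n → Bool) → (Fin n → Bool) → Fin n → Bool) (x y : ℕ) : ℕ :=
  valS (f (bitsS n x) (bitsS n y))

/-- The indexing function of a DLog/Index instance, computed by square-and-multiply
with identity index `idx` and generator index `g`. -/
def IdxG (n : ℕ) (f : (Fin n → Bool) → (Fin n → Bool) → Fin n → Bool)
    (idx g : ℕ) (x : ℕ) : ℕ :=
  valS (sqmul (fun r => f r r) (fun r => f (bitsS n g) r) (bitsS n idx) x)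

/-- A solution of the Index instance `(s, f, idx, g, t)`. -/
def IndexSol (s n : ℕ) (f : (Fin n → Bool) → (Fin n → Bool) → Fin n → Bool)
    (idx g t : ℕ) : Prop :=
  (∃ x < s, IdxG n f idx g x = t) ∨
  (∃ x < s, ∃ y < s, s ≤ fG n f x y) ∨
  (∃ x < s, ∃ y < s, x ≠ y ∧ IdxG n f idx g x = IdxG n f idx g y)

/-- The Pigeon instance built from an Index instance. -/
def Cind (s n : ℕ) (f : (Fin n → Bool) → (Fin n → Bool) → Fin n → Bool)
    (idx g t : ℕ) (x : Fin n → Bool) : Fin n → Bool :=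
  if valS x < s then bitsS n ((IdxG n f idx g (valS x) + s - t) % s) else x

theorem valS_succ {n : ℕ} (u : Fin (n + 1) → Bool) :
    valS u = 2 * valS (fun i : Fin n => u i.castSucc) +
      (if u (Fin.last n) then 1 else 0) := by
  simp only [valS, List.ofFn_succ_last, List.foldl_append, List.foldl_cons, List.foldl_nil]

theorem valS_lt {n : ℕ} (u : Fin n → Bool) : valS u < 2 ^ n := by
  induction n with
  | zero => simp [valS]
  | succ n ih =>
    have h := ih (fun i : Fin n => u i.castSucc)
    rw [valS_succ, pow_succ]
    split_ifs <;> omega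

theorem bitsS_valS {n : ℕ} (u : Fin n → Bool) : bitsS n (valS u) = u := by
  induction n with
  | zero => exact Subsingleton.elim _ _
  | succ n ih =>
    funext i
    induction i using Fin.lastCases with
    | last =>
      rw [valS_succ]
      cases h : u (Fin.last n) <;> simp [bitsS, Nat.testBit_zero]
    | cast i =>
      have h := congrFun (ih (fun i : Fin n => u i.castSucc)) i
      have hi : n + 1 - 1 - (i.castSucc : ℕ) = (n - 1 - (i : ℕ)) + 1 := by
        have := i.isLt
        simp only [Fin.val_castSucc]
        omega
      simp only [bitsS] at h ⊢
      rw [hi, Nat.testBit_succ, valS_succ, ← h]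
      congr 1
      split_ifs <;> omega

theorem bitsS_injOn (n : ℕ) : Set.InjOn (bitsS n) (Set.Iio (2 ^ n)) := by
  intro a ha b hb h
  refine Nat.eq_of_testBit_eq fun j => ?_
  by_cases hj : j < n
  · have h' := congrFun h ⟨n - 1 - j, by omega⟩
    have hj' : n - 1 - (n - 1 - j) = j := by omega
    simpa only [bitsS, hj'] using h'
  · have hp : 2 ^ n ≤ 2 ^ j := Nat.pow_le_pow_right (by norm_num) (by omega)
    rw [Nat.testBit_lt_two_pow (lt_of_lt_of_le ha hp),
      Nat.testBit_lt_two_pow (lt_of_lt_of_le hb hp)]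

theorem valS_injective (n : ℕ) : Function.Injective (valS : (Fin n → Bool) → ℕ) :=
  Function.LeftInverse.injective bitsS_valS

theorem valS_bitsS {n m : ℕ} (hm : m < 2 ^ n) : valS (bitsS n m) = m :=
  bitsS_injOn n (valS_lt _) hm (bitsS_valS _)

/-- An invariant preserved by squaring and multiplying holds for the result. -/
theorem sqmul_induction {α : Type*} {P : α → Prop} {sq mul : α → α} {e : α}
    (he : P e) (hsq : ∀ r, P r → P (sq r)) (hmul : ∀ r, P r → P (mul r)) (x : ℕ) :
    P (sqmul sq mul e x) := by
  unfold sqmul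
  generalize (if x = 0 then [false] else x.bits.reverse) = l
  induction l generalizing e with
  | nil => exact he
  | cons b l ih =>
    refine ih ?_
    cases b
    · exact hsq _ he
    · exact hmul _ (hsq _ he)

theorem IdxG_lt {s n : ℕ} (hsn : s ≤ 2 ^ n)
    {f : (Fin n → Bool) → (Fin n → Bool) → Fin n → Bool} {idx g : ℕ}
    (hidx : idx < s) (hg : g < s) (hf : ∀ x < s, ∀ y < s, fG n f x y < s) (x : ℕ) :
    IdxG n f idx g x < s := by
  have hf' : ∀ q r, valS q < s → valS r < s → valS (f q r) < s := fun q r hq hr => by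
    simpa only [fG, bitsS_valS] using hf _ hq _ hr
  have hbits : ∀ {m}, m < s → valS (bitsS n m) < s := fun hm => by
    rwa [valS_bitsS (hm.trans_le hsn)]
  exact sqmul_induction (P := fun r => valS r < s) (hbits hidx)
    (fun r hr => hf' r r hr hr) (fun r hr => hf' _ r (hbits hg) hr) x

theorem eq_of_add_sub_mod_eq {s t a b : ℕ} (ht : t < s) (ha : a < s) (hb : b < s)
    (h : (a + s - t) % s = (b + s - t) % s) : a = b := by
  have h' : a + (s - t) ≡ b + (s - t) [MOD s] := by
    rwa [Nat.ModEq, ← Nat.add_sub_assoc ht.le, ← Nat.add_sub_assoc ht.le]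
  exact (Nat.ModEq.add_right_cancel' _ h').eq_of_lt_of_lt ha hb

theorem index_to_pigeon (s : ℕ) (hs : 2 ≤ s) (n : ℕ) (hn : n = Nat.clog 2 s)
    (f : (Fin n → Bool) → (Fin n → Bool) → Fin n → Bool)
    (idx g t : ℕ) (hidx : idx < s) (hg : g < s) (ht : t < s) :
    (∀ x : Fin n → Bool, Cind s n f idx g t x = (fun _ => false) →
      IndexSol s n f idx g t) ∧
    (∀ x y : Fin n → Bool, x ≠ y → Cind s n f idx g t x = Cind s n f idx g t y →
      IndexSol s n f idx g t) := by
  have hsn : s ≤ 2 ^ n := hn ▸ Nat.le_pow_clog (by norm_num) s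
  have hmod : ∀ m, m % s < s := fun m => Nat.mod_lt m (by omega)
  by_cases hf : ∃ x < s, ∃ y < s, s ≤ fG n f x y
  · exact ⟨fun _ _ => Or.inr (Or.inl hf), fun _ _ _ _ => Or.inr (Or.inl hf)⟩
  push Not at hf
  have hI := IdxG_lt hsn hidx hg hf
  constructor
  · intro x hx
    have hzero : (fun _ => false) = bitsS n 0 := by
      funext i
      simp [bitsS]
    rw [hzero] at hx
    unfold Cind at hx
    split_ifs at hx with hxs
    · refine Or.inl ⟨valS x, hxs, eq_of_add_sub_mod_eq ht (hI _) ht ?_⟩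
      rw [bitsS_injOn n ((hmod _).trans_le hsn) (by simp) hx]
      simp
    · rw [hx, valS_bitsS (by positivity)] at hxs
      omega
  · intro x y hxy h
    unfold Cind at h
    have hne {m : ℕ} {z : Fin n → Bool} (hz : ¬ valS z < s) : bitsS n (m % s) ≠ z := by
      rintro rfl
      rw [valS_bitsS ((hmod m).trans_le hsn)] at hz
      exact hz (hmod m)
    split_ifs at h with hx hy hy
    · refine Or.inr (Or.inr ⟨valS x, hx, valS y, hy, (valS_injective n).ne hxy, ?_⟩)
      exact eq_of_add_sub_mod_eq ht (hI _) (hI _)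
        (bitsS_injOn n ((hmod _).trans_le hsn) ((hmod _).trans_le hsn) h)
    · exact absurd h (hne hy)
    · exact absurd h.symm (hne hx)
    · exact absurd h hxy
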